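/- arXiv:1501.05528 — 8 statements merged into one kernel-verified Lean document; each statement's English description precedes it below -/
import Mathlib

section
/- Let n ≥ 1. The set Chow_n consisting of all products ℓ_1 ⋯ ℓ_n of n linear forms is a closed subset of the space P_n of homogeneous polynomials of degree n in n variables over ℂ (with respect to the canonical topology on this finite-dimensional complex vector space). Equivalently: if a sequence of polynomials, each of which is a product of n linear forms, converges in P_n, then its limit is again a product of n linear forms. -/
open MvPolynomial

/-- The coefficientwise topology on the space of multivariate polynomials.  On any
finite-dimensional subspace, such as the space of homogeneous polynomials of a fixed
degree in finitely many variables, it coincides with the canonical Hausdorff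
vector-space topology. -/
noncomputable instance mvPolynomialTopology (σ : Type*) :
    TopologicalSpace (MvPolynomial σ ℂ) :=
  TopologicalSpace.induced (fun p (m : σ →₀ ℕ) => coeff m p) inferInstance

/-- The set of scalar multiples of a compact set avoiding the origin is closed. -/
theorem IsCompact.isClosed_setOf_smul {𝕜 E : Type*} [NontriviallyNormedField 𝕜] [ProperSpace 𝕜]
    [AddCommGroup E] [Module 𝕜 E] [TopologicalSpace E] [ContinuousSMul 𝕜 E] [T2Space E]
    {K : Set E} (hK : IsCompact K) (h0 : (0 : E) ∉ K) :
    IsClosed {x : E | ∃ c : 𝕜, ∃ k ∈ K, x = c • k} := by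
  obtain ⟨V, ⟨hV, hVb⟩, hVK⟩ :=
    (nhds_basis_balanced 𝕜 E).mem_iff.1 (hK.isClosed.isOpen_compl.mem_nhds h0)
  refine isClosed_of_closure_subset fun p hp => ?_
  have hlim : Filter.Tendsto (fun c : 𝕜 => c • p) (nhdsWithin 0 {0}ᶜ) (nhds 0) := by
    have : Continuous fun c : 𝕜 => c • p := by fun_prop
    simpa using (this.tendsto 0).mono_left nhdsWithin_le_nhds
  obtain ⟨a, ha, ha0⟩ :=
    ((hlim.eventually (eventually_mem_nhds_iff.2 hV)).and self_mem_nhdsWithin).exists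
  have ha0 : a ≠ 0 := ha0
  have hU : (fun x : E => a • x) ⁻¹' V ∈ nhds p := (continuous_const_smul a).continuousAt ha
  have hC : IsCompact ((fun q : 𝕜 × E => q.1 • q.2) ''
      (Metric.closedBall (0 : 𝕜) ‖a⁻¹‖ ×ˢ K)) :=
    ((isCompact_closedBall _ _).prod hK).image (by fun_prop)
  have hsub : {x : E | ∃ c : 𝕜, ∃ k ∈ K, x = c • k} ∩ (fun x : E => a • x) ⁻¹' V ⊆
      (fun q : 𝕜 × E => q.1 • q.2) '' (Metric.closedBall (0 : 𝕜) ‖a⁻¹‖ ×ˢ K) := by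
    rintro _ ⟨⟨c, k, hk, rfl⟩, hxV⟩
    refine ⟨(c, k), ⟨?_, hk⟩, rfl⟩
    rw [mem_closedBall_zero_iff]
    by_contra! hlt
    have hc : c ≠ 0 := norm_pos_iff.1 ((norm_nonneg _).trans_lt hlt)
    have hle : ‖c⁻¹ * a⁻¹‖ ≤ 1 := by
      rw [norm_mul, norm_inv c]
      exact inv_mul_le_one_of_le₀ hlt.le (norm_nonneg _)
    have hkV : (c⁻¹ * a⁻¹) • a • c • k ∈ V := hVb.smul_mem hle hxV
    rw [smul_smul, smul_smul, show c⁻¹ * a⁻¹ * a * c = 1 by field_simp, one_smul] at hkV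
    exact hVK hkV hk
  have hmem := hC.isClosed.closure_subset_iff.2 hsub <| mem_closure_iff_nhds.2 fun t ht => by
    simpa only [Set.inter_assoc, Set.inter_comm] using
      mem_closure_iff_nhds.1 hp _ (Filter.inter_mem ht hU)
  obtain ⟨⟨c, k⟩, ⟨-, hk⟩, rfl⟩ := hmem
  exact ⟨c, k, hk, rfl⟩

namespace MvPolynomial

/-- The linear form with prescribed coefficients. -/
noncomputable def linearForm {σ R : Type*} [Fintype σ] [CommSemiring R] (v : σ → R) :
    MvPolynomial σ R :=
  ∑ j, C (v j) * X j

section linearForm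

variable {σ R : Type*} [Fintype σ] [CommSemiring R]

theorem isHomogeneous_linearForm (v : σ → R) : (linearForm v).IsHomogeneous 1 :=
  IsHomogeneous.sum _ _ _ fun j _ => isHomogeneous_C_mul_X (v j) j

theorem coeff_single_linearForm (v : σ → R) (j : σ) :
    coeff (Finsupp.single j 1) (linearForm v) = v j := by
  classical
  simp [linearForm, coeff_sum, coeff_C_mul, coeff_X, Finsupp.single_left_inj]

theorem linearForm_smul (c : R) (v : σ → R) : linearForm (c • v) = C c * linearForm v := by
  simp [linearForm, Finset.mul_sum, mul_assoc]

theorem linearForm_ne_zero {v : σ → R} (hv : v ≠ 0) : linearForm v ≠ 0 := by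
  intro h
  apply hv
  ext j
  rw [← coeff_single_linearForm v j, h, coeff_zero, Pi.zero_apply]

theorem IsHomogeneous.exists_eq_linearForm {p : MvPolynomial σ R} (hp : p.IsHomogeneous 1) :
    ∃ v : σ → R, p = linearForm v := by
  rw [← mem_homogeneousSubmodule, homogeneousSubmodule_one_eq_span_X,
    Submodule.mem_span_range_iff_exists_fun] at hp
  obtain ⟨v, rfl⟩ := hp
  exact ⟨v, by simp only [linearForm, smul_eq_C_mul]⟩

theorem continuous_coeff_linearForm [TopologicalSpace R] [IsTopologicalSemiring R]
    (m : σ →₀ ℕ) : Continuous fun v : σ → R => coeff m (linearForm v) := by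
  simp only [linearForm, coeff_sum, coeff_C_mul]
  fun_prop

end linearForm

theorem continuous_coeff_prod {σ R T ι : Type*} [CommSemiring R] [TopologicalSpace R]
    [IsTopologicalSemiring R] [TopologicalSpace T] (s : Finset ι) {f : ι → T → MvPolynomial σ R}
    (hf : ∀ i ∈ s, ∀ m, Continuous fun t => coeff m (f i t)) (m : σ →₀ ℕ) :
    Continuous fun t => coeff m (∏ i ∈ s, f i t) := by
  classical
  induction s using Finset.induction_on generalizing m with
  | empty => simpa using continuous_const
  | insert a s ha ih =>
    simp only [Finset.prod_insert ha, coeff_mul]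
    exact continuous_finsetSum _ fun x _ => (hf a (Finset.mem_insert_self a s) x.1).mul
      (ih (fun i hi => hf i (Finset.mem_insert_of_mem hi)) x.2)

/-- A linear form in at least one variable is a scalar multiple of one whose coefficient vector
has norm one. -/
theorem IsHomogeneous.exists_eq_C_mul_linearForm {σ 𝕜 : Type*} [Fintype σ] [Nonempty σ] [RCLike 𝕜]
    {p : MvPolynomial σ 𝕜} (hp : p.IsHomogeneous 1) :
    ∃ (c : 𝕜) (v : σ → 𝕜), ‖v‖ = 1 ∧ p = C c * linearForm v := by
  obtain ⟨w, rfl⟩ := hp.exists_eq_linearForm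
  by_cases hw : w = 0
  · exact ⟨0, 1, norm_one, by simp [hw, linearForm]⟩
  · have hn : (‖w‖ : 𝕜) ≠ 0 := by simpa using hw
    refine ⟨‖w‖, (‖w‖⁻¹ : 𝕜) • w, norm_smul_inv_norm hw, ?_⟩
    rw [← linearForm_smul, smul_inv_smul₀ hn]

end MvPolynomial

/-- The set `Chow_n` of all products of `n` linear forms is a closed subset of the
space `P_n` of homogeneous polynomials of degree `n` in `n` variables over `ℂ`. -/
theorem chow_isClosed (n : ℕ) (hn : 1 ≤ n) :
    IsClosed {p : homogeneousSubmodule (Fin n) ℂ n |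
      ∃ ℓ : Fin n → MvPolynomial (Fin n) ℂ,
        (∀ i, (ℓ i).IsHomogeneous 1) ∧ (p : MvPolynomial (Fin n) ℂ) = ∏ i, ℓ i} := by
  have : Nonempty (Fin n) := ⟨⟨0, hn⟩⟩
  set F : (Fin n → Fin n → ℂ) → (Fin n →₀ ℕ) → ℂ :=
    fun v m => coeff m (∏ i, linearForm (v i)) with hF
  have hFc : Continuous F := continuous_pi <| continuous_coeff_prod _ fun i _ m =>
    (continuous_coeff_linearForm m).comp (continuous_apply i)
  have hK : IsCompact (F '' Set.univ.pi fun _ => Metric.sphere 0 1) :=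
    (isCompact_univ_pi fun _ => isCompact_sphere _ _).image hFc
  have h0 : (0 : (Fin n →₀ ℕ) → ℂ) ∉ F '' Set.univ.pi fun _ => Metric.sphere 0 1 := by
    rintro ⟨v, hv, hv0⟩
    refine Finset.prod_ne_zero_iff.2 (fun i _ => linearForm_ne_zero (v := v i) ?_)
      (MvPolynomial.ext _ _ fun m => congrFun hv0 m)
    exact ne_zero_of_mem_unit_sphere ⟨v i, hv i trivial⟩
  have hcoeff : Continuous fun (p : homogeneousSubmodule (Fin n) ℂ n) (m : Fin n →₀ ℕ) =>
      coeff m (p : MvPolynomial (Fin n) ℂ) :=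
    (continuous_induced_dom (f := fun (p : MvPolynomial (Fin n) ℂ) (m : Fin n →₀ ℕ) => coeff m p)).comp
      continuous_subtype_val
  convert (hK.isClosed_setOf_smul (𝕜 := ℂ) h0).preimage hcoeff using 1
  ext p
  constructor
  · rintro ⟨ℓ, hℓ, hp⟩
    choose c v hv hcv using fun i => (hℓ i).exists_eq_C_mul_linearForm
    refine ⟨∏ i, c i, F v, ⟨v, fun i _ => by simpa using hv i, rfl⟩, funext fun m => ?_⟩
    simp only [hp, hcv, Finset.prod_mul_distrib, ← map_prod, coeff_C_mul, hF, Pi.smul_apply,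
      smul_eq_mul]
  · rintro ⟨c, _, ⟨v, -, rfl⟩, hp⟩
    obtain ⟨r, hr⟩ := IsAlgClosed.exists_pow_nat_eq c hn
    refine ⟨fun i => linearForm (r • v i), fun i => isHomogeneous_linearForm _, ?_⟩
    ext m
    simpa [linearForm_smul, Finset.prod_mul_distrib, ← map_pow, hr, coeff_C_mul, hF]
      using congrFun hp m
end

section
/- Let n ≥ 1. The closure (in the space P_n of homogeneous degree-n polynomials in n variables over ℂ) of the orbit { g • (X_1 ⋯ X_n) : g ∈ GL_n(ℂ) } of the monomial X_1 ⋯ X_n under the action of GL_n(ℂ) by linear substitution of variables equals the set Chow_n of all products ℓ_1 ⋯ ℓ_n of n linear forms. -/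
open MvPolynomial
open scoped MatrixGroups

/-- The action of `g ∈ GL_n(ℂ)` on polynomials by linear substitution of variables:
`X j ↦ ∑ i, g i j • X i`. -/
noncomputable def glAction {n : ℕ} (g : GL (Fin n) ℂ) (p : MvPolynomial (Fin n) ℂ) :
    MvPolynomial (Fin n) ℂ :=
  aeval (fun j => ∑ i, C ((g : Matrix (Fin n) (Fin n) ℂ) i j) * X i) p

/-- The linear form `∑ i, b i • X i`. -/
noncomputable def linForm {n : ℕ} (b : Fin n → ℂ) : MvPolynomial (Fin n) ℂ :=
  ∑ i, C (b i) * X i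

lemma linForm_isHomogeneous {n : ℕ} (b : Fin n → ℂ) : (linForm b).IsHomogeneous 1 :=
  IsHomogeneous.sum _ _ _ fun i _ => isHomogeneous_C_mul_X (b i) i

lemma exists_eq_linForm {n : ℕ} {p : MvPolynomial (Fin n) ℂ} (hp : p.IsHomogeneous 1) :
    ∃ b, p = linForm b := by
  have h : p ∈ homogeneousSubmodule (Fin n) ℂ 1 := hp
  rw [homogeneousSubmodule_one_eq_span_X, Submodule.mem_span_range_iff_exists_fun] at h
  obtain ⟨b, rfl⟩ := h
  exact ⟨b, by simp [linForm, smul_eq_C_mul]⟩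

lemma coeff_single_linForm {n : ℕ} (b : Fin n → ℂ) (i : Fin n) :
    coeff (Finsupp.single i 1) (linForm b) = b i := by
  simp [linForm, coeff_sum, coeff_C_mul, coeff_X, Finsupp.single_left_inj]

lemma linForm_ne_zero {n : ℕ} {b : Fin n → ℂ} (hb : b ≠ 0) : linForm b ≠ 0 := by
  intro h
  apply hb
  ext i
  rw [← coeff_single_linForm b i, h, coeff_zero, Pi.zero_apply]

lemma linForm_smul {n : ℕ} (c : ℂ) (b : Fin n → ℂ) :
    linForm (c • b) = C c * linForm b := by
  simp [linForm, Finset.mul_sum, mul_assoc]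

lemma continuous_coeff_linForm {n : ℕ} (m : Fin n →₀ ℕ) :
    Continuous fun b : Fin n → ℂ => coeff m (linForm b) := by
  simp only [linForm, coeff_sum, coeff_C_mul]
  fun_prop

lemma continuous_coeff_prod {σ ι α : Type*} [TopologicalSpace α] (s : Finset ι)
    {f : ι → α → MvPolynomial σ ℂ} (hf : ∀ i m, Continuous fun a => coeff m (f i a))
    (m : σ →₀ ℕ) : Continuous fun a => coeff m (∏ i ∈ s, f i a) := by
  classical
  induction s using Finset.induction_on generalizing m with
  | empty => simpa using continuous_const
  | insert i s hi ih =>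
    simp only [Finset.prod_insert hi, coeff_mul]
    exact continuous_finsetSum _ fun x _ => (hf i x.1).mul (ih x.2)

lemma continuous_coeff_prod_linForm {n : ℕ} (m : Fin n →₀ ℕ) :
    Continuous fun B : Fin n → Fin n → ℂ => coeff m (∏ j, linForm (B j)) :=
  continuous_coeff_prod _
    (fun j m => (continuous_coeff_linForm m).comp (continuous_apply j)) m

lemma isInducing_coeff (σ : Type*) :
    Topology.IsInducing fun (p : MvPolynomial σ ℂ) (m : σ →₀ ℕ) => coeff m p :=
  ⟨rfl⟩

lemma continuous_coeff {σ : Type*} (m : σ →₀ ℕ) :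
    Continuous fun p : MvPolynomial σ ℂ => coeff m p :=
  (continuous_apply m).comp (isInducing_coeff σ).continuous

lemma glAction_prod_X {n : ℕ} (g : GL (Fin n) ℂ) :
    glAction g (∏ i, X i) =
      ∏ j, linForm fun i => (g : Matrix (Fin n) (Fin n) ℂ) i j := by
  simp [glAction, linForm]

/-- The products of `n` linear forms, as a subset of the space of forms of degree `n`. -/
def chow (n : ℕ) : Set (homogeneousSubmodule (Fin n) ℂ n) :=
  {p | ∃ ℓ : Fin n → MvPolynomial (Fin n) ℂ,
    (∀ i, (ℓ i).IsHomogeneous 1) ∧ (p : MvPolynomial (Fin n) ℂ) = ∏ i, ℓ i}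

lemma exists_smul_eq_of_norm_eq_one {E : Type*} [NormedAddCommGroup E] [NormedSpace ℂ E]
    [Nontrivial E] (v : E) : ∃ (c : ℂ) (w : E), ‖w‖ = 1 ∧ v = c • w := by
  by_cases hv : v = 0
  · obtain ⟨w, hw⟩ := exists_norm_eq E zero_le_one
    exact ⟨0, w, hw, by simp [hv]⟩
  · refine ⟨‖v‖, (‖v‖ : ℂ)⁻¹ • v, ?_, ?_⟩
    · simp [norm_smul, hv]
    · rw [smul_inv_smul₀ (by simpa using hv)]

lemma exists_normalized_of_mem_chow {n : ℕ} (hn : 1 ≤ n)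
    {p : homogeneousSubmodule (Fin n) ℂ n} (hp : p ∈ chow n) :
    ∃ (c : ℂ) (B : Fin n → Fin n → ℂ), (∀ j, ‖B j‖ = 1) ∧
      (p : MvPolynomial (Fin n) ℂ) = C c * ∏ j, linForm (B j) := by
  have : Nonempty (Fin n) := ⟨⟨0, hn⟩⟩
  obtain ⟨ℓ, hℓ, hp⟩ := hp
  choose b hb using fun i => exists_eq_linForm (hℓ i)
  choose c w hw hbw using fun j => exists_smul_eq_of_norm_eq_one (b j)
  refine ⟨∏ j, c j, w, hw, ?_⟩
  rw [hp, map_prod, ← Finset.prod_mul_distrib]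
  exact Finset.prod_congr rfl fun j _ => by rw [hb, hbw, linForm_smul]

lemma mem_chow_of_eq_C_mul {n : ℕ} (hn : 1 ≤ n) {p : homogeneousSubmodule (Fin n) ℂ n}
    (c : ℂ) (B : Fin n → Fin n → ℂ)
    (hp : (p : MvPolynomial (Fin n) ℂ) = C c * ∏ j, linForm (B j)) : p ∈ chow n := by
  obtain ⟨d, rfl⟩ := IsAlgClosed.exists_pow_nat_eq c (n := n) hn
  refine ⟨fun j => linForm (d • B j), fun j => linForm_isHomogeneous _, ?_⟩
  simp [hp, linForm_smul, Finset.prod_mul_distrib]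

lemma isClosed_chow {n : ℕ} (hn : 1 ≤ n) : IsClosed (chow n) := by
  rw [isClosed_iff_ultrafilter]
  intro x u hux hu
  choose! c B hB hp using fun p (hp : p ∈ chow n) => exists_normalized_of_mem_chow hn hp
  have hK : IsCompact (Set.univ.pi fun _ : Fin n => Metric.sphere (0 : Fin n → ℂ) 1) :=
    isCompact_univ_pi fun _ => isCompact_sphere 0 1
  obtain ⟨b, hbK, hb⟩ := hK.ultrafilter_le_nhds (u.map B) <| Filter.le_principal_iff.2 <|
    Filter.mem_map.2 <| Filter.mem_of_superset hu fun p hp j _ => by simpa using hB p hp j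
  have hlim (m : Fin n →₀ ℕ) : Filter.Tendsto (fun p => coeff m (∏ j, linForm (B p j))) u
      (nhds (coeff m (∏ j, linForm (b j)))) :=
    ((continuous_coeff_prod_linForm m).tendsto b).comp hb
  have hlim' (m : Fin n →₀ ℕ) :
      Filter.Tendsto (fun p : homogeneousSubmodule (Fin n) ℂ n => coeff m p.1) u
        (nhds (coeff m x.1)) :=
    (((continuous_coeff m).comp continuous_subtype_val).tendsto x).mono_left hux
  have hq : ∏ j, linForm (b j) ≠ 0 := Finset.prod_ne_zero_iff.2 fun j _ =>
    linForm_ne_zero fun h => by simpa [h] using hbK j (Set.mem_univ j)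
  obtain ⟨m₀, hm₀⟩ := ne_zero_iff.1 hq
  refine mem_chow_of_eq_C_mul hn (coeff m₀ x.1 / coeff m₀ (∏ j, linForm (b j))) b ?_
  ext m
  have h : coeff m₀ (∏ j, linForm (b j)) * coeff m x.1 =
      coeff m₀ x.1 * coeff m (∏ j, linForm (b j)) := by
    refine tendsto_nhds_unique_of_eventuallyEq ((hlim m₀).mul (hlim' m))
      ((hlim' m₀).mul (hlim m)) ?_
    filter_upwards [hu] with p hps
    rw [hp p hps, coeff_C_mul, coeff_C_mul]
    ring
  rw [coeff_C_mul]
  field_simp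
  linear_combination h

lemma eventually_isUnit_add_smul_one {n : ℕ} (A : Matrix (Fin n) (Fin n) ℂ) :
    ∀ᶠ t : ℂ in nhdsWithin 0 {0}ᶜ, IsUnit (A + t • (1 : Matrix (Fin n) (Fin n) ℂ)) := by
  have hfin : {t | (-A).charpoly.IsRoot t}.Finite :=
    Polynomial.finite_setOfPred_isRoot (-A).charpoly_monic.ne_zero
  have h : ∀ᶠ t : ℂ in nhdsWithin 0 {0}ᶜ, t ∉ {t | (-A).charpoly.IsRoot t} := by
    have := (hfin.sdiff (t := {0})).isClosed.compl_mem_nhds (x := (0 : ℂ)) (by simp)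
    filter_upwards [mem_nhdsWithin_of_mem_nhds this, self_mem_nhdsWithin] with t ht h0 hr
    exact ht ⟨hr, h0⟩
  filter_upwards [h] with t ht
  rw [Matrix.isUnit_iff_isUnit_det, isUnit_iff_ne_zero]
  simpa [Polynomial.IsRoot, Matrix.eval_charpoly, add_comm, Matrix.smul_one_eq_diagonal] using ht

/-- The closure, in the space `P_n` of homogeneous polynomials of degree `n` in `n`
variables over `ℂ`, of the `GL_n(ℂ)`-orbit of the monomial `X 1 ⋯ X n` equals the set
`Chow_n` of all products of `n` linear forms. -/
theorem closure_orbit_monomial_eq_chow (n : ℕ) (hn : 1 ≤ n) :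
    closure {p : homogeneousSubmodule (Fin n) ℂ n |
        ∃ g : GL (Fin n) ℂ,
          (p : MvPolynomial (Fin n) ℂ) = glAction g (∏ i, X i)} =
      {p : homogeneousSubmodule (Fin n) ℂ n |
        ∃ ℓ : Fin n → MvPolynomial (Fin n) ℂ,
          (∀ i, (ℓ i).IsHomogeneous 1) ∧ (p : MvPolynomial (Fin n) ℂ) = ∏ i, ℓ i} := by
  apply Set.Subset.antisymm
  · refine closure_minimal ?_ (isClosed_chow hn)
    rintro p ⟨g, hg⟩
    exact ⟨_, fun j => linForm_isHomogeneous _, hg.trans (glAction_prod_X g)⟩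
  · rintro p ⟨ℓ, hℓ, hp⟩
    choose b hb using fun i => exists_eq_linForm (hℓ i)
    have hhom (B : Fin n → Fin n → ℂ) :
        ∏ j, linForm (B j) ∈ homogeneousSubmodule (Fin n) ℂ n := by
      simpa using IsHomogeneous.prod Finset.univ (fun j => linForm (B j)) (fun _ => 1)
        fun j _ => linForm_isHomogeneous (B j)
    let A : Matrix (Fin n) (Fin n) ℂ := Matrix.of fun i j => b j i
    let M : ℂ → Fin n → Fin n → ℂ := fun t j i => (A + t • (1 : Matrix (Fin n) (Fin n) ℂ)) i j
    let F : ℂ → homogeneousSubmodule (Fin n) ℂ n := fun t => ⟨_, hhom (M t)⟩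
    have hM : Continuous M := by
      simp only [M, Matrix.add_apply, Matrix.smul_apply]
      fun_prop
    have hF : Continuous F := by
      refine Continuous.subtype_mk ((isInducing_coeff _).continuous_iff.2 ?_) _
      exact continuous_pi fun m => (continuous_coeff_prod_linForm m).comp hM
    have hF0 : F 0 = p := Subtype.ext <| by simp [F, M, A, hp, hb]
    rw [← hF0]
    refine mem_closure_of_tendsto (b := nhdsWithin 0 {0}ᶜ) ((hF.tendsto 0).mono_left nhdsWithin_le_nhds) ?_
    filter_upwards [eventually_isUnit_add_smul_one A] with t ht
    exact ⟨ht.unit, by rw [glAction_prod_X]; rfl⟩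
end

section
/- Let R be an integral domain on which a group G acts by ring automorphisms, and suppose that every nonzero G-stable ideal of R contains a nonzero G-invariant element. Let K = Frac(R) be the fraction field of R, with the induced G-action by field automorphisms. Then every G-invariant element f of K can be written as f = p/q with p, q ∈ R^G and q ≠ 0; that is, the fraction field of the invariant ring R^G equals the field of G-invariants K^G. -/
/-- If the fraction `x / y` is `g`-invariant and `x / y = p / r`, then
`x / y = (g • p) / (g • r)`. -/
theorem mul_smul_eq_smul_mul_of_cross_mul {R : Type*} [CommRing R] [IsDomain R]
    {G : Type*} [Group G] [MulSemiringAction G R] {g : G} {x y p r : R} (hy : y ≠ 0)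
    (hinv : (g • x) * y = x * (g • y)) (h : x * r = p * y) :
    x * (g • r) = (g • p) * y := by
  have hg : (g • x) * (g • r) = (g • p) * (g • y) := by rw [← smul_mul', h, smul_mul']
  have hgy : g • y ≠ 0 := (smul_ne_zero_iff_ne g).mpr hy
  refine mul_right_cancel₀ hgy ?_
  linear_combination y * hg - (g • r) * hinv

/-- Let a group `G` act by ring automorphisms on an integral domain `R` such that every
nonzero `G`-stable ideal of `R` contains a nonzero `G`-invariant element.  Then every
`G`-invariant element of the fraction field `K = Frac R` is a quotient of two
`G`-invariant elements of `R`; that is, `Frac (R^G) = K^G`.  Here an element of `K` is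
represented as a fraction `x / y` with `x, y ∈ R`, `y ≠ 0`; its `G`-invariance is
expressed by the cross-multiplication identity `(g • x) * y = x * (g • y)` for all
`g ∈ G`, and the conclusion `x / y = p / q` by `x * q = p * y`. -/
theorem frac_invariants_eq_invariant_frac {R : Type*} [CommRing R] [IsDomain R]
    {G : Type*} [Group G] [MulSemiringAction G R]
    (hstab : ∀ I : Ideal R, I ≠ ⊥ → (∀ g : G, ∀ r ∈ I, g • r ∈ I) →
      ∃ r ∈ I, r ≠ 0 ∧ ∀ g : G, g • r = r)
    (x y : R) (hy : y ≠ 0) (hinv : ∀ g : G, (g • x) * y = x * (g • y)) :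
    ∃ p q : R, q ≠ 0 ∧ (∀ g : G, g • p = p) ∧ (∀ g : G, g • q = q) ∧ x * q = p * y := by
  let I : Ideal R := Submodule.comap (LinearMap.mulLeft R x) (Ideal.span {y})
  have mem_I (r : R) : r ∈ I ↔ ∃ p, x * r = p * y := by
    simp [I, Ideal.mem_span_singleton', eq_comm]
  have hI : I ≠ ⊥ := (Submodule.ne_bot_iff I).mpr ⟨y, (mem_I y).mpr ⟨x, rfl⟩, hy⟩
  obtain ⟨q, hqI, hq0, hq⟩ := hstab I hI fun g r hr => by
    obtain ⟨p, hp⟩ := (mem_I r).mp hr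
    exact (mem_I _).mpr ⟨g • p, mul_smul_eq_smul_mul_of_cross_mul hy (hinv g) hp⟩
  obtain ⟨p, hp⟩ := (mem_I q).mp hqI
  refine ⟨p, q, hq0, fun g => mul_right_cancel₀ hy ?_, hq, hp⟩
  rw [← mul_smul_eq_smul_mul_of_cross_mul hy (hinv g) hp, hq g, hp]
end

section
/- Let R be an integral domain which is integrally closed in its fraction field, and let a group G act on R by ring automorphisms. Then the invariant subring R^G is an integral domain which is integrally closed in its own fraction field. (In particular, the categorical quotient of a normal affine variety by a group acting on its coordinate ring is normal.) -/
/-- The subring `R^G` of `G`-invariant elements of a ring `R` with an action of a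
group `G` by ring automorphisms. -/
def fixedSubring (G R : Type*) [Monoid G] [CommRing R] [MulSemiringAction G R] :
    Subring R where
  carrier := {x | ∀ g : G, g • x = x}
  zero_mem' := fun g => smul_zero g
  one_mem' := fun g => smul_one g
  add_mem' := fun {a b} ha hb g => by rw [smul_add, ha g, hb g]
  mul_mem' := fun {a b} ha hb g => by rw [smul_mul', ha g, hb g]
  neg_mem' := fun {a} ha g => by rw [smul_neg, ha g]

/-- If a group `G` acts by ring automorphisms on an integrally closed integral domain
`R`, then the invariant ring `R^G` is an integral domain which is integrally closed in
its own fraction field. -/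
theorem fixedSubring_isIntegrallyClosed {R : Type*} [CommRing R] [IsDomain R]
    {G : Type*} [Group G] [MulSemiringAction G R] (hR : IsIntegrallyClosed R) :
    IsDomain (fixedSubring G R) ∧ IsIntegrallyClosed (fixedSubring G R) := by
  refine ⟨inferInstance, (isIntegrallyClosed_iff (FractionRing (fixedSubring G R))).2 ?_⟩
  intro x hx
  have hinj : Function.Injective (fixedSubring G R).subtype := Subtype.val_injective
  let φ : FractionRing (fixedSubring G R) →+* FractionRing R := IsFractionRing.map hinj
  have hφ (a : fixedSubring G R) : φ (algebraMap _ _ a) = algebraMap R _ (a : R) :=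
    IsLocalization.map_eq _ a
  have hint : IsIntegral R (φ x) :=
    hx.map_of_comp_eq (fixedSubring G R).subtype φ (RingHom.ext fun a => (hφ a).symm)
  obtain ⟨r, hr⟩ := IsIntegrallyClosed.isIntegral_iff.1 hint
  obtain ⟨⟨a, b⟩, hab⟩ := IsLocalization.surj (nonZeroDivisors (fixedSubring G R)) x
  have hrb : r * (b : fixedSubring G R) = (a : R) := by
    apply IsFractionRing.injective R (FractionRing R)
    rw [map_mul, hr, ← hφ, ← hφ, ← map_mul, hab]
  have hb : ((b : fixedSubring G R) : R) ≠ 0 := fun h =>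
    nonZeroDivisors.coe_ne_zero b (Subtype.ext h)
  have hfix : r ∈ fixedSubring G R := fun g => mul_right_cancel₀ hb <| by
    have h := congrArg (g • ·) hrb
    simp only [smul_mul'] at h
    rwa [(b : fixedSubring G R).2 g, a.2 g, ← hrb] at h
  exact ⟨⟨r, hfix⟩, φ.injective ((hφ _).trans hr)⟩
end

section
/- Let M be an additive abelian group and let A be an integral domain graded by M (that is, A = ⊕_{μ∈M} A_μ as an internal direct sum of additive subgroups with A_μ · A_ν ⊆ A_{μ+ν}). Let R ⊆ A be a graded subring (i.e., a subring containing all homogeneous components of each of its elements). Let f ∈ A be a nonzero homogeneous element of degree λ satisfying a monic equation f^e + Σ_{i=0}^{e−1} a_i f^i = 0 with e ≥ 1 and a_0, …, a_{e−1} ∈ R. Then there exists an index i with 0 ≤ i < e such that R contains a nonzero homogeneous element of degree (e−i)·λ; indeed, writing a_{i,μ} for the degree-μ component of a_i, one has f^e + Σ_{i=0}^{e−1} a_{i,(e−i)λ} f^i = 0 and not all a_{i,(e−i)λ} vanish. -/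
open DirectSum

/-- Let `A` be an integral domain graded by an abelian group `M`, and let `R ⊆ A` be a
graded subring.  If a nonzero homogeneous element `f` of degree `λ` satisfies a monic
equation `f^e + ∑_{i<e} a i * f^i = 0` with coefficients `a i ∈ R`, then the
homogeneous components `a_{i,(e-i)λ}` of the coefficients again give a relation
`f^e + ∑_{i<e} a_{i,(e-i)λ} * f^i = 0`, and some `a_{i,(e-i)λ}` with `i < e` is a
nonzero homogeneous element of `R` of degree `(e-i) • λ`. -/
theorem graded_integral_equation_homogeneous_components
    {M A σ : Type*} [AddCommGroup M] [DecidableEq M] [CommRing A] [IsDomain A]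
    [SetLike σ A] [AddSubmonoidClass σ A] (𝒜 : M → σ) [GradedRing 𝒜]
    (R : Subring A) (hR : ∀ r ∈ R, ∀ μ : M, (decompose 𝒜 r μ : A) ∈ R)
    (f : A) (hf0 : f ≠ 0) (lam : M) (hf : f ∈ 𝒜 lam)
    (e : ℕ) (he : 1 ≤ e) (a : ℕ → A) (ha : ∀ i < e, a i ∈ R)
    (heq : f ^ e + ∑ i ∈ Finset.range e, a i * f ^ i = 0) :
    (f ^ e + ∑ i ∈ Finset.range e,
        (decompose 𝒜 (a i) ((e - i) • lam) : A) * f ^ i = 0) ∧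
      ∃ i < e, (decompose 𝒜 (a i) ((e - i) • lam) : A) ≠ 0 ∧
        (decompose 𝒜 (a i) ((e - i) • lam) : A) ∈ R ∧
        (decompose 𝒜 (a i) ((e - i) • lam) : A) ∈ 𝒜 ((e - i) • lam) := by
  have hterm : ∀ i ∈ Finset.range e, GradedRing.proj 𝒜 (e • lam) (a i * f ^ i) =
      (decompose 𝒜 (a i) ((e - i) • lam) : A) * f ^ i := by
    intro i hi
    have hdeg : e • lam = (e - i) • lam + i • lam := by
      rw [← add_smul, Nat.sub_add_cancel (Finset.mem_range.mp hi).le]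
    rw [GradedRing.proj_apply, hdeg]
    exact coe_decompose_mul_add_of_right_mem 𝒜 (SetLike.pow_mem_graded i hf)
  have hrel : f ^ e + ∑ i ∈ Finset.range e,
      (decompose 𝒜 (a i) ((e - i) • lam) : A) * f ^ i = 0 := by
    have hproj := congrArg (GradedRing.proj 𝒜 (e • lam)) heq
    rw [map_add, map_sum, map_zero, Finset.sum_congr rfl hterm, GradedRing.proj_apply,
      decompose_of_mem_same 𝒜 (SetLike.pow_mem_graded e hf)] at hproj
    exact hproj
  refine ⟨hrel, ?_⟩
  by_contra hnone
  have hzero : ∀ i ∈ Finset.range e,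
      (decompose 𝒜 (a i) ((e - i) • lam) : A) * f ^ i = 0 := by
    intro i hi
    have hie := Finset.mem_range.mp hi
    by_contra hne
    exact hnone ⟨i, hie, left_ne_zero_of_mul hne, hR _ (ha i hie) _, SetLike.coe_mem _⟩
  rw [Finset.sum_eq_zero hzero, add_zero] at hrel
  exact pow_ne_zero e hf0 hrel
end

section
/- Let M be an additive abelian group and let A be an integral domain graded by M. Let R ⊆ A be a graded subring such that A is generated as an R-module by e elements (e ≥ 1). Then for every λ ∈ M with A_λ ≠ 0 there exists an integer j with 1 ≤ j ≤ e such that R contains a nonzero homogeneous element of degree j·λ. -/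
open DirectSum

/-- An eigenvalue `f` in a domain of a matrix with entries in a subring `R`
is a root of the characteristic polynomial of that matrix. -/
theorem Matrix.eval₂_charpoly_eq_zero_of_mulVec_eq_smul {A n : Type*} [CommRing A] [IsDomain A]
    [Fintype n] [DecidableEq n] (R : Subring A) (C : Matrix n n R) (v : n → A) (hv : v ≠ 0)
    (f : A) (h : (C.map R.subtype).mulVec v = f • v) :
    C.charpoly.eval₂ R.subtype f = 0 := by
  rw [← Polynomial.eval_map, ← Matrix.charpoly_map, Matrix.eval_charpoly,
    ← Matrix.exists_mulVec_eq_zero_iff]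
  refine ⟨v, hv, ?_⟩
  rw [Matrix.sub_mulVec, h, Matrix.scalar_apply, ← Matrix.smul_one_eq_diagonal,
    Matrix.smul_mulVec, Matrix.one_mulVec, sub_self]

/-- Let `A` be an integral domain graded by an abelian group `M`, and let `R ⊆ A` be a
graded subring such that `A` is generated as an `R`-module by `e` elements (`e ≥ 1`).
Then for every `λ ∈ M` with `A_λ ≠ 0` there is an integer `j` with `1 ≤ j ≤ e` such
that `R` contains a nonzero homogeneous element of degree `j • λ`. -/
theorem graded_subring_contains_homogeneous_multiple
    {M A σ : Type*} [AddCommGroup M] [DecidableEq M] [CommRing A] [IsDomain A]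
    [SetLike σ A] [AddSubmonoidClass σ A] (𝒜 : M → σ) [GradedRing 𝒜]
    (R : Subring A) (hR : ∀ r ∈ R, ∀ μ : M, (decompose 𝒜 r μ : A) ∈ R)
    (e : ℕ) (he : 1 ≤ e) (gen : Fin e → A)
    (hgen : ∀ x : A, ∃ c : Fin e → A, (∀ k, c k ∈ R) ∧ x = ∑ k, c k * gen k)
    (lam : M) (hlam : ∃ f ∈ 𝒜 lam, f ≠ 0) :
    ∃ j : ℕ, 1 ≤ j ∧ j ≤ e ∧ ∃ r ∈ R, r ≠ 0 ∧ r ∈ 𝒜 (j • lam) := by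
  obtain ⟨f, hf, hf0⟩ := hlam
  choose c hcR hc using fun i => hgen (f * gen i)
  have hgen0 : gen ≠ 0 := by
    rintro rfl
    obtain ⟨d, -, hd⟩ := hgen 1
    simp at hd
  set C : Matrix (Fin e) (Fin e) R := Matrix.of fun i k => ⟨c i k, hcR i k⟩ with hC
  have hroot := Matrix.eval₂_charpoly_eq_zero_of_mulVec_eq_smul R C gen hgen0 f (by
    ext i
    simp [Matrix.mulVec, dotProduct, hC, hc])
  have hdeg : C.charpoly.natDegree = e := by
    simp [Matrix.charpoly_natDegree_eq_dim]
  have hlead : C.charpoly.coeff e = 1 := by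
    simpa [hdeg] using C.charpoly_monic.coeff_natDegree
  rw [Polynomial.eval₂_eq_sum_range, hdeg, Finset.sum_range_succ, hlead, map_one, one_mul]
    at hroot
  by_contra! hno
  have hterm : ∀ i ∈ Finset.range e,
      GradedRing.proj 𝒜 (e • lam) (R.subtype (C.charpoly.coeff i) * f ^ i) = 0 := by
    intro i hi
    have hie : i < e := Finset.mem_range.mp hi
    have hsplit : e • lam = (e - i) • lam + i • lam := by
      rw [← add_smul, Nat.sub_add_cancel hie.le]
    rw [GradedRing.proj_apply, hsplit,
      coe_decompose_mul_add_of_right_mem 𝒜 (SetLike.pow_mem_graded i hf)]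
    refine mul_eq_zero_of_left (by_contra fun h0 => ?_) _
    exact hno (e - i) (by omega) (by omega) _ (hR _ (C.charpoly.coeff i).2 _) h0
      (SetLike.coe_mem _)
  have hproj := congrArg (GradedRing.proj 𝒜 (e • lam)) hroot
  rw [map_add, map_sum, Finset.sum_eq_zero hterm, zero_add, map_zero, GradedRing.proj_apply,
    decompose_of_mem_same 𝒜 (SetLike.pow_mem_graded e hf)] at hproj
  exact pow_ne_zero e hf0 hproj
end

section
/- For every integer n > 2, the inequality (n² − n)! < n^{n² − 2n} · n! · ((n−1)!)^n holds; equivalently, (n² − n)! / (n! · ((n−1)!)^n) < n^{n² − 2n}. -/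
open Nat

theorem factorial_mul_succ_le (n k : ℕ) :
    (n * (k + 1))! ≤ n ^ (n * k) * (n ! * ((k + 1)!) ^ n) := by
  induction k with
  | zero => simp
  | succ k ih =>
    calc (n * (k + 1 + 1))! = (n * (k + 1))! * (n * (k + 1) + 1).ascFactorial n := by
          rw [Nat.factorial_mul_ascFactorial, ← Nat.mul_succ]
      _ ≤ n ^ (n * k) * (n ! * ((k + 1)!) ^ n) * (n * (k + 1) + n) ^ n :=
          Nat.mul_le_mul ih (Nat.ascFactorial_le_pow_add _ _)
      _ = n ^ (n * (k + 1)) * (n ! * ((k + 1 + 1)!) ^ n) := by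
          rw [Nat.factorial_succ (k + 1), ← mul_add_one, mul_pow, mul_pow, Nat.mul_succ n k,
            pow_add]
          ring

theorem factorial_mul_add_two_lt {n : ℕ} (hn : 2 ≤ n) (k : ℕ) :
    (n * (k + 2))! < n ^ (n * (k + 1)) * (n ! * ((k + 2)!) ^ n) := by
  calc (n * (k + 2))! = (n * (k + 1))! * (n * (k + 1) + 1).ascFactorial n := by
        rw [Nat.factorial_mul_ascFactorial, ← Nat.mul_succ]
    _ < (n * (k + 1))! * (n * (k + 1) + n) ^ n :=
        Nat.mul_lt_mul_of_pos_left (Nat.ascFactorial_lt_pow_add _ hn) (Nat.factorial_pos _)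
    _ ≤ n ^ (n * k) * (n ! * ((k + 1)!) ^ n) * (n * (k + 1) + n) ^ n :=
        Nat.mul_le_mul_right _ (factorial_mul_succ_le n k)
    _ = n ^ (n * (k + 1)) * (n ! * ((k + 2)!) ^ n) := by
        rw [Nat.factorial_succ (k + 1), ← mul_add_one, mul_pow, mul_pow, Nat.mul_succ n k,
          pow_add]
        ring

/-- For every integer `n > 2` one has `(n² − n)! < n^(n² − 2n) · n! · ((n−1)!)^n`;
equivalently, `D = (n² − n)! / (n! · ((n−1)!)^n) < n^(n² − 2n)`. -/
theorem factorial_bound (n : ℕ) (hn : 2 < n) :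
    (n ^ 2 - n)! < n ^ (n ^ 2 - 2 * n) * (n ! * ((n - 1)!) ^ n) := by
  obtain ⟨k, rfl⟩ : ∃ k, n = k + 3 := ⟨n - 3, by omega⟩
  have h₁ : (k + 3) ^ 2 - (k + 3) = (k + 3) * (k + 2) := Nat.sub_eq_of_eq_add (by ring)
  have h₂ : (k + 3) ^ 2 - 2 * (k + 3) = (k + 3) * (k + 1) := Nat.sub_eq_of_eq_add (by ring)
  rw [h₁, h₂]
  exact factorial_mul_add_two_lt (by omega) k
end

section
/- Define R : ℝ → ℝ by R(x) = (e/√(2π))^x · exp(1/(12x)) · (x−1)^{(1−x)/2}. Then R is strictly decreasing on the interval [2, ∞), and R(3) < 1. Consequently R(x) < 1 for all real x ≥ 3. -/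
/-- The function `R(x) = (e/√(2π))^x · exp(1/(12x)) · (x−1)^((1−x)/2)` appearing in
the Stirling estimate, where the last factor is the real power
`exp(((1−x)/2) · log(x−1))`. -/
noncomputable def stirlingR (x : ℝ) : ℝ :=
  (Real.exp 1 / Real.sqrt (2 * Real.pi)) ^ x * Real.exp (1 / (12 * x)) *
    (x - 1) ^ ((1 - x) / 2)

theorem stirlingR_eq_exp {x : ℝ} (hx : 1 < x) :
    stirlingR x = Real.exp (x * (1 - Real.log (2 * Real.pi) / 2) + 1 / (12 * x) +
      (1 - x) / 2 * Real.log (x - 1)) := by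
  have hpi : 0 < 2 * Real.pi := by positivity
  rw [stirlingR, Real.rpow_def_of_pos (by positivity), Real.rpow_def_of_pos (by linarith),
    Real.log_div (Real.exp_pos 1).ne' (Real.sqrt_pos.2 hpi).ne', Real.log_exp,
    Real.log_sqrt hpi.le, ← Real.exp_add, ← Real.exp_add]
  ring_nf

theorem five_mul_log_two_lt_two_mul_log_two_pi :
    5 * Real.log 2 < 2 * Real.log (2 * Real.pi) := by
  have h : Real.log ((2 : ℝ) ^ 5) < Real.log ((2 * Real.pi) ^ 2) :=
    Real.log_lt_log (by positivity) (by nlinarith [Real.pi_gt_three])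
  simpa only [Real.log_pow, Nat.cast_ofNat] using h

theorem sub_le_mul_log_sub_mul_log {u v : ℝ} (hu : 1 ≤ u) (huv : u ≤ v) :
    v - u ≤ v * Real.log v - u * Real.log u := by
  have hu0 : 0 < u := by linarith
  have hv0 : 0 < v := by linarith
  have h1 := Real.one_sub_inv_le_log_of_pos (div_pos hv0 hu0)
  rw [Real.log_div hv0.ne' hu0.ne', inv_div] at h1
  have h2 := mul_le_mul_of_nonneg_left h1 hv0.le
  have h3 : v * (1 - u / v) = v - u := by field_simp
  nlinarith [mul_nonneg (sub_nonneg.2 huv) (Real.log_nonneg hu)]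

theorem strictAntiOn_stirlingR : StrictAntiOn stirlingR (Set.Ici (2 : ℝ)) := by
  intro x hx y hy hxy
  rw [Set.mem_Ici] at hx hy
  rw [stirlingR_eq_exp (by linarith : 1 < x), stirlingR_eq_exp (by linarith : 1 < y),
    Real.exp_lt_exp]
  have hlog : 1 < Real.log (2 * Real.pi) := by
    linarith [five_mul_log_two_lt_two_mul_log_two_pi, Real.log_two_gt_d9]
  have hinv : 1 / (12 * y) ≤ 1 / (12 * x) :=
    one_div_le_one_div_of_le (by linarith) (by linarith)
  have hmul := sub_le_mul_log_sub_mul_log (u := x - 1) (v := y - 1) (by linarith) (by linarith)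
  nlinarith [mul_pos (sub_pos.2 hxy) (sub_pos.2 hlog)]

theorem stirlingR_three_lt_one : stirlingR 3 < 1 := by
  rw [stirlingR_eq_exp (by norm_num), Real.exp_lt_one_iff]
  norm_num
  linarith [five_mul_log_two_lt_two_mul_log_two_pi, Real.log_two_gt_d9]

/-- `R` is strictly decreasing on `[2, ∞)` and `R(3) < 1`; consequently `R(x) < 1` for
all real `x ≥ 3`. -/
theorem stirlingR_lt_one :
    StrictAntiOn stirlingR (Set.Ici (2 : ℝ)) ∧ stirlingR 3 < 1 ∧
      ∀ x : ℝ, 3 ≤ x → stirlingR x < 1 := by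
  refine ⟨strictAntiOn_stirlingR, stirlingR_three_lt_one, fun x hx => ?_⟩
  refine lt_of_le_of_lt (strictAntiOn_stirlingR.antitoneOn ?_ ?_ hx) stirlingR_three_lt_one
  · norm_num
  · exact Set.mem_Ici.2 (by linarith)
end
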